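/- For a simple compact convex polytope P = {x : f_i(x) ≥ 0}, there is a constant C > 0 such that ‖dΦ_x(w)‖₂ ≥ C‖w‖_x for all x ∈ int P and w ∈ ℝⁿ, where Φ(x) = Σ_i log(f_i(x)) ∇f_i and ‖·‖_x is the Hilbert Finsler norm. Consequently, the Hilbert metric of a simple polytope is bilipschitz to ℝⁿ with the Euclidean norm. -/

import Mathlib

open RealInnerProductSpace

section Polytope

variable {E ι : Type*} [NormedAddCommGroup E] [InnerProductSpace ℝ E]

/-- The intersection of the half-spaces `⟪g i, x⟫ + b i ≥ 0`. -/
def polyhedron (g : ι → E) (b : ι → ℝ) : Set E := {x | ∀ i, 0 ≤ ⟪g i, x⟫ + b i}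

theorem isClosed_polyhedron (g : ι → E) (b : ι → ℝ) : IsClosed (polyhedron g b) := by
  simp only [polyhedron, Set.ofPred_forall]
  exact isClosed_iInter fun i => isClosed_le continuous_const (by fun_prop)

theorem interior_polyhedron [Finite ι] {g : ι → E} (b : ι → ℝ) (hg : ∀ i, g i ≠ 0) :
    interior (polyhedron g b) = {x | ∀ i, 0 < ⟪g i, x⟫ + b i} := by
  apply Set.Subset.antisymm
  · intro x hx i
    have hlim : Filter.Tendsto (fun t : ℝ => x - t • g i) (nhds 0) (nhds x) := by
      have : Continuous fun t : ℝ => x - t • g i := by fun_prop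
      simpa using this.tendsto 0
    have hev := (hlim.eventually (isOpen_interior.mem_nhds hx)).filter_mono
      (nhdsWithin_le_nhds (s := Set.Ioi (0 : ℝ)))
    obtain ⟨t, ht, ht0⟩ := (hev.and self_mem_nhdsWithin).exists
    have h := interior_subset ht i
    rw [inner_sub_right, inner_smul_right] at h
    have : 0 < t * ⟪g i, g i⟫ := mul_pos ht0 (real_inner_self_pos.2 (hg i))
    linarith
  · refine interior_maximal (fun x hx i => (hx i).le) ?_
    simp only [Set.ofPred_forall]
    exact isOpen_iInter_of_finite fun i => isOpen_lt continuous_const (by fun_prop)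

theorem eq_zero_of_inner_nonneg {g : ι → E} {b : ι → ℝ}
    (hP : Bornology.IsBounded (polyhedron g b)) {x w : E} (hx : x ∈ polyhedron g b)
    (hw : ∀ i, 0 ≤ ⟪g i, w⟫) : w = 0 := by
  obtain ⟨R, hR⟩ := hP.exists_norm_le
  by_contra hne
  have hpos : 0 < ‖w‖ := norm_pos_iff.2 hne
  have hR0 : 0 ≤ R := (norm_nonneg x).trans (hR x hx)
  obtain ⟨t, ht0, ht⟩ : ∃ t : ℝ, 0 ≤ t ∧ t * ‖w‖ = 2 * R + 1 :=
    ⟨(2 * R + 1) / ‖w‖, by positivity, by field_simp⟩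
  have hmem : x + t • w ∈ polyhedron g b := fun i => by
    have := hx i
    have := mul_nonneg ht0 (hw i)
    rw [inner_add_right, inner_smul_right]
    linarith
  have h1 : ‖t • w‖ ≤ ‖x + t • w‖ + ‖x‖ := by
    simpa using norm_sub_le (x + t • w) x
  rw [norm_smul, Real.norm_of_nonneg ht0, ht] at h1
  linarith [hR x hx, hR _ hmem]

theorem exists_norm_le_mul_norm_inner [Fintype ι] [FiniteDimensional ℝ E] {g : ι → E} {b : ι → ℝ}
    (hP : Bornology.IsBounded (polyhedron g b)) (hne : (polyhedron g b).Nonempty) :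
    ∃ B : ℝ, 0 ≤ B ∧ ∀ w : E, ‖w‖ ≤ B * ‖fun i => ⟪g i, w⟫‖ := by
  obtain ⟨x, hx⟩ := hne
  let T : E →ₗ[ℝ] (ι → ℝ) := LinearMap.pi fun i => (innerSL ℝ (g i)).toLinearMap
  have hker : LinearMap.ker T = ⊥ := by
    refine LinearMap.ker_eq_bot'.2 fun w hw => eq_zero_of_inner_nonneg hP hx fun i => ?_
    exact (congrFun hw i).ge
  obtain ⟨K, -, hK⟩ := T.exists_antilipschitzWith hker
  refine ⟨K, K.2, fun w => ?_⟩
  have h := hK.le_mul_dist w 0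
  rwa [map_zero, dist_zero_right, dist_zero_right] at h

theorem exists_active_subset_extremePoint {g : ι → E} {b : ι → ℝ}
    (hP : IsCompact (polyhedron g b)) {x : E} (hx : x ∈ polyhedron g b) :
    ∃ p ∈ Set.extremePoints ℝ (polyhedron g b), ∀ i, ⟪g i, x⟫ + b i = 0 → ⟪g i, p⟫ + b i = 0 := by
  let F : Set E := polyhedron g b ∩ {y | ∀ i, ⟪g i, x⟫ + b i = 0 → ⟪g i, y⟫ + b i = 0}
  have hFcomp : IsCompact F := by
    refine hP.inter_right ?_
    simp only [Set.ofPred_forall]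
    exact isClosed_iInter fun i => isClosed_iInter fun _ =>
      isClosed_eq (by fun_prop) continuous_const
  have hFext : IsExtreme ℝ (polyhedron g b) F := by
    refine ⟨Set.inter_subset_left, ?_⟩
    rintro y hy z hz u hu ⟨s, t, hs, ht, hst, rfl⟩
    refine ⟨hy, fun i hi => ?_⟩
    have h := hu.2 i hi
    rw [inner_add_right, inner_smul_right, inner_smul_right] at h
    have h1 := hy i
    have h2 := mul_nonneg ht.le (hz i)
    have h3 : s * (⟪g i, y⟫ + b i) + t * (⟪g i, z⟫ + b i) = 0 := by
      linear_combination h + b i * hst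
    have h4 : s * (⟪g i, y⟫ + b i) ≤ 0 := by linarith
    exact le_antisymm (nonpos_of_mul_nonpos_right h4 hs) h1
  obtain ⟨p, hp⟩ := hFcomp.extremePoints_nonempty ⟨x, hx, fun _ h => h⟩
  exact ⟨p, hFext.extremePoints_subset_extremePoints hp, (extremePoints_subset hp).2⟩

theorem eq_zero_of_inner_active_eq_zero [Finite ι] {g : ι → E} {b : ι → ℝ} {p v : E}
    (hp : p ∈ Set.extremePoints ℝ (polyhedron g b))
    (hv : ∀ i, ⟪g i, p⟫ + b i = 0 → ⟪g i, v⟫ = 0) : v = 0 := by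
  have hpP := hp.1
  have key : ∀ u : E, (∀ i, ⟪g i, p⟫ + b i = 0 → ⟪g i, u⟫ = 0) →
      ∀ᶠ t : ℝ in nhds 0, p + t • u ∈ polyhedron g b := by
    intro u hu
    simp only [polyhedron, Set.mem_ofPred_eq]
    refine Filter.eventually_all.2 fun i => ?_
    rcases (hpP i).eq_or_lt with h | h
    · refine Filter.Eventually.of_forall fun t => ?_
      rw [inner_add_right, inner_smul_right, hu i h.symm]
      linarith
    · have hc : Continuous fun t : ℝ => ⟪g i, p + t • u⟫ + b i := by fun_prop
      exact (hc.tendsto 0).eventually_const_le (by simpa using h)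
  have hev := (key v hv).and (key (-v) fun i hi => by rw [inner_neg_right, hv i hi, neg_zero])
  obtain ⟨t, ⟨h1, h2⟩, ht⟩ := ((hev.filter_mono
    (nhdsWithin_le_nhds (s := Set.Ioi (0 : ℝ)))).and self_mem_nhdsWithin).exists
  have h := hp.2 h1 h2 ⟨1 / 2, 1 / 2, by norm_num, by norm_num, by norm_num, by module⟩
  have h' : t • v = 0 := by simpa using h
  exact (smul_eq_zero.1 h').resolve_left (ne_of_gt ht)

/-- In a simple polytope, the normals of the hyperplanes through a point are independent. -/
theorem eq_zero_of_sum_smul_eq_zero [Fintype ι] [FiniteDimensional ℝ E] {g : ι → E} {b : ι → ℝ}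
    (hP : IsCompact (polyhedron g b))
    (hsimple : ∀ p ∈ Set.extremePoints ℝ (polyhedron g b),
      {i | ⟪g i, p⟫ + b i = 0}.ncard = Module.finrank ℝ E)
    {x : E} (hx : x ∈ polyhedron g b) {ρ : ι → ℝ} (hρ : ∀ i, ρ i ≠ 0 → ⟪g i, x⟫ + b i = 0)
    (hsum : ∑ i, ρ i • g i = 0) : ρ = 0 := by
  classical
  obtain ⟨p, hp, hsub⟩ := exists_active_subset_extremePoint hP hx
  let A : Finset ι := {i | ⟪g i, p⟫ + b i = 0}
  have hspan : ⊤ ≤ Submodule.span ℝ (Set.range fun i : A => g i) := by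
    rw [top_le_iff, ← Submodule.orthogonal_eq_bot_iff, Submodule.eq_bot_iff]
    intro v hv
    refine eq_zero_of_inner_active_eq_zero hp fun i hi => ?_
    exact (Submodule.mem_orthogonal _ _).1 hv _
      (Submodule.subset_span ⟨⟨i, by simpa [A] using hi⟩, rfl⟩)
  have hcard : Fintype.card A = Module.finrank ℝ E := by
    rw [← hsimple p hp, Fintype.card_coe, Set.ncard_eq_toFinset_card']
    simp [A]
  have hli : LinearIndepOn ℝ g (A : Set ι) :=
    linearIndependent_of_top_le_span_of_card_eq_finrank hspan hcard
  have hzero : ∀ i ∉ A, ρ i = 0 := fun i hi => by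
    by_contra h
    exact hi (by simpa [A] using hsub i (hρ i h))
  have hA : ∑ i ∈ A, ρ i • g i = 0 := by
    rw [← hsum]
    exact Finset.sum_subset A.subset_univ fun i _ hi => by rw [hzero i hi, zero_smul]
  ext i
  by_cases hi : i ∈ A
  · exact linearIndepOn_finset_iff.1 hli ρ hA i hi
  · exact hzero i hi

/-- By compactness, `‖∑ i, ρ i • g i‖` is bounded below by `‖ρ‖` up to a term supported away from the
facets through `x`. -/
theorem exists_pos_mul_norm_sq_le [Fintype ι] [FiniteDimensional ℝ E] {g : ι → E} {b : ι → ℝ}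
    (hP : IsCompact (polyhedron g b))
    (hsimple : ∀ p ∈ Set.extremePoints ℝ (polyhedron g b),
      {i | ⟪g i, p⟫ + b i = 0}.ncard = Module.finrank ℝ E) :
    ∃ δ > 0, ∀ x ∈ polyhedron g b, ∀ ρ : ι → ℝ,
      δ * ‖ρ‖ ^ 2 ≤ ‖ρ‖ * ‖∑ i, ρ i • g i‖ + ∑ i, (⟪g i, x⟫ + b i) * ρ i ^ 2 := by
  let G : E × (ι → ℝ) → ℝ := fun z =>
    ‖∑ i, z.2 i • g i‖ + ∑ i, (⟪g i, z.1⟫ + b i) * z.2 i ^ 2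
  have hG : Continuous G := by fun_prop
  have hK : IsCompact (polyhedron g b ×ˢ Metric.sphere (0 : ι → ℝ) 1) :=
    hP.prod (isCompact_sphere _ _)
  obtain ⟨δ, hδ, h⟩ : ∃ δ > 0, ∀ z ∈ polyhedron g b ×ˢ Metric.sphere (0 : ι → ℝ) 1, δ ≤ G z := by
    rcases (polyhedron g b ×ˢ Metric.sphere (0 : ι → ℝ) 1).eq_empty_or_nonempty with he | hne
    · exact ⟨1, one_pos, by simp [he]⟩
    obtain ⟨⟨x, ρ⟩, ⟨hx, hρ⟩, hmin⟩ := hK.exists_isMinOn hne hG.continuousOn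
    refine ⟨G (x, ρ), ?_, fun z hz => hmin hz⟩
    have hterm : ∀ i ∈ Finset.univ, 0 ≤ (⟪g i, x⟫ + b i) * ρ i ^ 2 :=
      fun i _ => mul_nonneg (hx i) (sq_nonneg _)
    have hs := Finset.sum_nonneg hterm
    refine lt_of_le_of_ne (add_nonneg (norm_nonneg _) hs) fun h0 => ?_
    have h1 : ‖∑ i, ρ i • g i‖ = 0 := by
      have := norm_nonneg (∑ i, ρ i • g i)
      simp only [G] at h0
      linarith
    have h2 : ∑ i, (⟪g i, x⟫ + b i) * ρ i ^ 2 = 0 := by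
      simp only [G] at h0
      linarith
    have hρ0 : ρ = 0 := by
      refine eq_zero_of_sum_smul_eq_zero hP hsimple hx (fun i hi => ?_) (norm_eq_zero.1 h1)
      have := (Finset.sum_eq_zero_iff_of_nonneg hterm).1 h2 i (Finset.mem_univ i)
      exact (mul_eq_zero.1 this).resolve_right (pow_ne_zero 2 hi)
    simp [hρ0] at hρ
  refine ⟨δ, hδ, fun x hx ρ => ?_⟩
  rcases eq_or_ne ρ 0 with rfl | hρ
  · simp
  have hpos : 0 < ‖ρ‖ := norm_pos_iff.2 hρ
  have hu := h (x, ‖ρ‖⁻¹ • ρ) ⟨hx, by simp [norm_smul, hpos.ne']⟩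
  have e1 : ∑ i, (‖ρ‖⁻¹ • ρ) i • g i = ‖ρ‖⁻¹ • ∑ i, ρ i • g i := by
    simp [Finset.smul_sum, mul_smul]
  have e2 : ∑ i, (⟪g i, x⟫ + b i) * (‖ρ‖⁻¹ • ρ) i ^ 2
      = (‖ρ‖⁻¹) ^ 2 * ∑ i, (⟪g i, x⟫ + b i) * ρ i ^ 2 := by
    rw [Finset.mul_sum]
    refine Finset.sum_congr rfl fun i _ => ?_
    simp only [Pi.smul_apply, smul_eq_mul]
    ring
  simp only [G] at hu
  rw [e1, e2, norm_smul, norm_inv, norm_norm] at hu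
  calc δ * ‖ρ‖ ^ 2 ≤ (‖ρ‖⁻¹ * ‖∑ i, ρ i • g i‖
        + (‖ρ‖⁻¹) ^ 2 * ∑ i, (⟪g i, x⟫ + b i) * ρ i ^ 2) * ‖ρ‖ ^ 2 := by gcongr
    _ = _ := by field_simp

theorem exists_forall_inner_add_le [Finite ι] {g : ι → E} {b : ι → ℝ}
    (hP : IsCompact (polyhedron g b)) :
    ∃ M : ℝ, 0 ≤ M ∧ ∀ x ∈ polyhedron g b, ∀ i, ⟪g i, x⟫ + b i ≤ M := by
  have := Fintype.ofFinite ι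
  obtain ⟨M, hM⟩ := hP.exists_bound_of_continuousOn
    (f := fun x i => ⟪g i, x⟫ + b i) (by fun_prop)
  refine ⟨max M 0, le_max_right _ _, fun x hx i => ?_⟩
  exact (le_abs_self _).trans
    ((norm_le_pi_norm (fun i => ⟪g i, x⟫ + b i) i).trans ((hM x hx).trans (le_max_left _ _)))

/-- The line through an interior point leaves the polytope at time `-(q j)⁻¹`, where `q j` is the
least of the ratios `⟪g i, w⟫ / f i x`. -/
theorem exists_exit_point [Finite ι] {g : ι → E} {b : ι → ℝ} (hg : ∀ i, g i ≠ 0)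
    (hP : Bornology.IsBounded (polyhedron g b)) {x w : E} (hx : ∀ i, 0 < ⟪g i, x⟫ + b i)
    (hw : w ≠ 0) :
    ∃ j, ⟪g j, w⟫ / (⟪g j, x⟫ + b j) < 0 ∧
      (∀ i, ⟪g j, w⟫ / (⟪g j, x⟫ + b j) ≤ ⟪g i, w⟫ / (⟪g i, x⟫ + b i)) ∧
      x + (-(⟪g j, w⟫ / (⟪g j, x⟫ + b j)))⁻¹ • w ∈ frontier (polyhedron g b) := by
  obtain ⟨k, hk⟩ : ∃ k, ⟪g k, w⟫ < 0 := by
    by_contra! h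
    exact hw (eq_zero_of_inner_nonneg hP (fun i => (hx i).le) h)
  have : Nonempty ι := ⟨k⟩
  obtain ⟨j, hj⟩ := Finite.exists_min fun i => ⟪g i, w⟫ / (⟪g i, x⟫ + b i)
  have hj0 := (hj k).trans_lt (div_neg_of_neg_of_pos hk (hx k))
  refine ⟨j, hj0, hj, ?_⟩
  set q := ⟪g j, w⟫ / (⟪g j, x⟫ + b j) with hq
  have hval : ∀ i, ⟪g i, x + (-q)⁻¹ • w⟫ + b i
      = (⟪g i, x⟫ + b i) * (-q)⁻¹ * (⟪g i, w⟫ / (⟪g i, x⟫ + b i) - q) := fun i => by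
    have h1 := (hx i).ne'
    have h2 := hj0.ne
    rw [inner_add_right, inner_smul_right]
    field_simp
    ring
  rw [(isClosed_polyhedron g b).frontier_eq, interior_polyhedron b hg]
  refine ⟨fun i => ?_, fun h => ?_⟩
  · rw [hval]
    have := (hx i).le
    have := sub_nonneg.2 (hj i)
    have : 0 ≤ -q := by linarith
    positivity
  · have := h j
    rw [hval, ← hq, sub_self, mul_zero] at this
    exact this.false

theorem exists_pos_mul_norm_logDeriv_le [Fintype ι] [FiniteDimensional ℝ E] {g : ι → E} {b : ι → ℝ}
    (hP : IsCompact (polyhedron g b))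
    (hsimple : ∀ p ∈ Set.extremePoints ℝ (polyhedron g b),
      {i | ⟪g i, p⟫ + b i = 0}.ncard = Module.finrank ℝ E) :
    ∃ C > 0, ∀ x, (∀ i, 0 < ⟪g i, x⟫ + b i) → ∀ w : E,
      C * ‖fun i => ⟪g i, w⟫ / (⟪g i, x⟫ + b i)‖
        ≤ ‖∑ i, (⟪g i, w⟫ / (⟪g i, x⟫ + b i)) • g i‖ := by
  rcases (polyhedron g b).eq_empty_or_nonempty with he | hne
  · refine ⟨1, one_pos, fun x hx => ?_⟩
    have : x ∈ polyhedron g b := fun i => (hx i).le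
    simp [he] at this
  obtain ⟨δ, hδ, hmain⟩ := exists_pos_mul_norm_sq_le hP hsimple
  obtain ⟨B, hB, hnorm⟩ := exists_norm_le_mul_norm_inner hP.isBounded hne
  obtain ⟨M, hM0, hM⟩ := exists_forall_inner_add_le hP
  refine ⟨δ / (1 + B * M), by positivity, fun x hx w => ?_⟩
  set q : ι → ℝ := fun i => ⟪g i, w⟫ / (⟪g i, x⟫ + b i) with hq
  set S := ∑ i, q i • g i with hS
  have hxP : x ∈ polyhedron g b := fun i => (hx i).le
  have hqf : ∀ i, ⟪g i, w⟫ = (⟪g i, x⟫ + b i) * q i := fun i => by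
    have := (hx i).ne'
    simp only [hq]
    field_simp
  have hsum : ∑ i, (⟪g i, x⟫ + b i) * q i ^ 2 = ⟪S, w⟫ := by
    rw [hS, sum_inner]
    refine Finset.sum_congr rfl fun i _ => ?_
    rw [inner_smul_left, hqf i]
    simp only [conj_trivial]
    ring
  have hwn : ‖w‖ ≤ B * (M * ‖q‖) := by
    refine (hnorm w).trans (mul_le_mul_of_nonneg_left ?_ hB)
    refine (pi_norm_le_iff_of_nonneg (by positivity)).2 fun i => ?_
    rw [hqf i, norm_mul, Real.norm_of_nonneg (hx i).le]
    exact mul_le_mul (hM x hxP i) (norm_le_pi_norm q i) (norm_nonneg _) hM0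
  have h1 := hmain x hxP q
  rw [hsum] at h1
  have h2 : ⟪S, w⟫ ≤ ‖S‖ * (B * (M * ‖q‖)) :=
    (real_inner_le_norm S w).trans (mul_le_mul_of_nonneg_left hwn (norm_nonneg _))
  rcases (norm_nonneg q).eq_or_lt with h0 | hpos
  · rw [← h0, mul_zero]
    exact norm_nonneg _
  rw [div_mul_eq_mul_div, div_le_iff₀ (by positivity)]
  refine le_of_mul_le_mul_right ?_ hpos
  linarith

theorem sub_le_mul_log_sub_log {a c : ℝ} (ha : 0 < a) (hc : 0 < c) :
    a - c ≤ a * (Real.log a - Real.log c) := by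
  have h := Real.log_le_sub_one_of_pos (div_pos hc ha)
  rw [Real.log_div hc.ne' ha.ne'] at h
  have h' := mul_le_mul_of_nonneg_left h ha.le
  have e : a * (c / a - 1) = c - a := by field_simp
  linarith

theorem abs_sub_le_mul_abs_log_sub_log {a c M : ℝ} (ha : 0 < a) (hc : 0 < c) (haM : a ≤ M)
    (hcM : c ≤ M) : |a - c| ≤ M * |Real.log a - Real.log c| := by
  rcases le_total c a with h | h
  · have hl := Real.log_le_log hc h
    rw [abs_of_nonneg (by linarith), abs_of_nonneg (by linarith)]
    exact (sub_le_mul_log_sub_log ha hc).trans (mul_le_mul_of_nonneg_right haM (by linarith))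
  · have hl := Real.log_le_log ha h
    rw [abs_sub_comm, abs_sub_comm (Real.log a), abs_of_nonneg (by linarith),
      abs_of_nonneg (by linarith)]
    exact (sub_le_mul_log_sub_log hc ha).trans (mul_le_mul_of_nonneg_right hcM (by linarith))

theorem mul_sq_log_sub_log_le {a c : ℝ} (ha : 0 < a) (hc : 0 < c) :
    a * (Real.log a - Real.log c) ^ 2
      ≤ (1 + |Real.log a - Real.log c|) * ((Real.log a - Real.log c) * (a - c)) := by
  have h1 := sub_le_mul_log_sub_log ha hc
  have h2 := sub_le_mul_log_sub_log hc ha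
  set r := Real.log a - Real.log c with hr
  rcases le_total c a with h | h
  · have hr0 : 0 ≤ r := sub_nonneg.2 (Real.log_le_log hc h)
    rw [abs_of_nonneg hr0]
    have h3 : c * r ≤ a - c := by linarith
    nlinarith [mul_le_mul_of_nonneg_left h3 hr0]
  · have hr0 : r ≤ 0 := sub_nonpos.2 (Real.log_le_log ha h)
    rw [abs_of_nonpos hr0]
    nlinarith [mul_le_mul_of_nonpos_left h1 hr0, mul_nonneg (mul_nonneg_of_nonpos_of_nonpos hr0
      (sub_nonpos.2 h)) (neg_nonneg.2 hr0)]

theorem exists_pos_mul_norm_log_sub_log_le [Fintype ι] [FiniteDimensional ℝ E] {g : ι → E}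
    {b : ι → ℝ} (hP : IsCompact (polyhedron g b))
    (hsimple : ∀ p ∈ Set.extremePoints ℝ (polyhedron g b),
      {i | ⟪g i, p⟫ + b i = 0}.ncard = Module.finrank ℝ E) :
    ∃ C > 0, ∀ x y, (∀ i, 0 < ⟪g i, x⟫ + b i) → (∀ i, 0 < ⟪g i, y⟫ + b i) →
      C * ‖fun i => Real.log (⟪g i, x⟫ + b i) - Real.log (⟪g i, y⟫ + b i)‖
        ≤ ‖∑ i, (Real.log (⟪g i, x⟫ + b i) - Real.log (⟪g i, y⟫ + b i)) • g i‖ := by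
  rcases (polyhedron g b).eq_empty_or_nonempty with he | hne
  · refine ⟨1, one_pos, fun x _ hx => ?_⟩
    have : x ∈ polyhedron g b := fun i => (hx i).le
    simp [he] at this
  obtain ⟨δ, hδ, hmain⟩ := exists_pos_mul_norm_sq_le hP hsimple
  obtain ⟨B, hB, hnorm⟩ := exists_norm_le_mul_norm_inner hP.isBounded hne
  obtain ⟨M, hM0, hM⟩ := exists_forall_inner_add_le hP
  obtain ⟨R, hR⟩ := hP.isBounded.exists_norm_le
  have hR0 : 0 ≤ R := (norm_nonneg _).trans (hR _ hne.some_mem)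
  refine ⟨δ / (1 + B * M + 2 * R), by positivity, fun x y hx hy => ?_⟩
  set r : ι → ℝ := fun i => Real.log (⟪g i, x⟫ + b i) - Real.log (⟪g i, y⟫ + b i) with hr
  set S := ∑ i, r i • g i with hS
  have hxP : x ∈ polyhedron g b := fun i => (hx i).le
  have hyP : y ∈ polyhedron g b := fun i => (hy i).le
  have hdiff : ∀ i, ⟪g i, x - y⟫ = (⟪g i, x⟫ + b i) - (⟪g i, y⟫ + b i) := fun i => by
    rw [inner_sub_right]
    ring
  have hterm : ∀ i, 0 ≤ r i * ⟪g i, x - y⟫ := fun i => by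
    rw [hdiff i]
    rcases le_total (⟪g i, x⟫ + b i) (⟪g i, y⟫ + b i) with h | h
    · exact mul_nonneg_of_nonpos_of_nonpos (sub_nonpos.2 (Real.log_le_log (hx i) h))
        (sub_nonpos.2 h)
    · exact mul_nonneg (sub_nonneg.2 (Real.log_le_log (hy i) h)) (sub_nonneg.2 h)
  have hsum : ∑ i, (⟪g i, x⟫ + b i) * r i ^ 2 ≤ (1 + ‖r‖) * ⟪S, x - y⟫ := by
    rw [hS, sum_inner, Finset.mul_sum]
    refine Finset.sum_le_sum fun i _ => ?_
    rw [inner_smul_left]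
    refine (mul_sq_log_sub_log_le (hx i) (hy i)).trans ?_
    rw [← hdiff i]
    have : |r i| ≤ ‖r‖ := norm_le_pi_norm r i
    exact mul_le_mul_of_nonneg_right (by linarith) (hterm i)
  have hn1 : ‖x - y‖ ≤ B * (M * ‖r‖) := by
    refine (hnorm _).trans (mul_le_mul_of_nonneg_left ?_ hB)
    refine (pi_norm_le_iff_of_nonneg (by positivity)).2 fun i => ?_
    rw [hdiff i]
    refine (abs_sub_le_mul_abs_log_sub_log (hx i) (hy i) (hM x hxP i) (hM y hyP i)).trans ?_
    exact mul_le_mul_of_nonneg_left (norm_le_pi_norm r i) hM0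
  have hn2 : ‖x - y‖ ≤ 2 * R := by
    linarith [norm_sub_le x y, hR x hxP, hR y hyP]
  have h1 := hmain x hxP r
  have h2 : (1 + ‖r‖) * ⟪S, x - y⟫ ≤ ‖S‖ * ((B * M + 2 * R) * ‖r‖) := by
    calc (1 + ‖r‖) * ⟪S, x - y⟫ ≤ (1 + ‖r‖) * (‖S‖ * ‖x - y‖) := by
          gcongr
          exact real_inner_le_norm _ _
      _ = ‖S‖ * (‖x - y‖ + ‖r‖ * ‖x - y‖) := by ring
      _ ≤ ‖S‖ * (B * (M * ‖r‖) + ‖r‖ * (2 * R)) := by gcongr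
      _ = _ := by ring
  rcases (norm_nonneg r).eq_or_lt with h0 | hpos
  · rw [← h0, mul_zero]
    exact norm_nonneg _
  rw [div_mul_eq_mul_div, div_le_iff₀ (by positivity)]
  refine le_of_mul_le_mul_right ?_ hpos
  linarith

theorem exists_log_cross_ratio_eq [Finite ι] {g : ι → E} {b : ι → ℝ} (hg : ∀ i, g i ≠ 0)
    (hP : Bornology.IsBounded (polyhedron g b)) {x y : E} (hx : ∀ i, 0 < ⟪g i, x⟫ + b i)
    (hy : ∀ i, 0 < ⟪g i, y⟫ + b i) (hxy : x ≠ y) {r : ι → ℝ}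
    (hr : ∀ i, r i = Real.log (⟪g i, x⟫ + b i) - Real.log (⟪g i, y⟫ + b i)) :
    ∃ a₁ ∈ frontier (polyhedron g b), ∃ a₂ ∈ frontier (polyhedron g b),
      (∃ t₁ t₂ : ℝ, t₁ < 0 ∧ 1 < t₂ ∧ a₁ = x + t₁ • (y - x) ∧ a₂ = x + t₂ • (y - x)) ∧
      ∃ j k, r k ≤ 0 ∧ 0 ≤ r j ∧ (∀ i, r k ≤ r i ∧ r i ≤ r j) ∧
        Real.log ((‖y - a₁‖ / ‖x - a₁‖) * (‖x - a₂‖ / ‖y - a₂‖)) = r j - r k := by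
  have hw : y - x ≠ 0 := sub_ne_zero.2 hxy.symm
  set q : ι → ℝ := fun i => ⟪g i, y - x⟫ / (⟪g i, x⟫ + b i) with hq
  have hqneg : ∀ i, ⟪g i, -(y - x)⟫ / (⟪g i, x⟫ + b i) = -q i := fun i => by
    rw [inner_neg_right, neg_div]
  obtain ⟨j, hj0, hj, hja⟩ := exists_exit_point hg hP hx hw
  obtain ⟨k, hk0, hk, hka⟩ := exists_exit_point hg hP hx (neg_ne_zero.2 hw)
  simp only [hqneg] at hk0 hk hka
  have hratio : ∀ i, 1 + q i = (⟪g i, y⟫ + b i) / (⟪g i, x⟫ + b i) := fun i => by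
    have := (hx i).ne'
    simp only [hq, inner_sub_right]
    field_simp
    ring
  have hpos : ∀ i, 0 < 1 + q i := fun i => by
    rw [hratio]
    exact div_pos (hy i) (hx i)
  have hrq : ∀ i, r i = -Real.log (1 + q i) := fun i => by
    rw [hratio, Real.log_div (hy i).ne' (hx i).ne', hr]
    ring
  change q j < 0 at hj0
  have hk0 : 0 < q k := by linarith
  have hk : ∀ i, q i ≤ q k := fun i => by linarith [hk i]
  have hj : ∀ i, q j ≤ q i := hj
  rw [neg_neg, smul_neg, ← neg_smul] at hka
  refine ⟨_, hka, _, hja, ⟨_, _, neg_lt_zero.2 (inv_pos.2 hk0), ?_, rfl, rfl⟩, j, k, ?_, ?_,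
    fun i => ⟨?_, ?_⟩, ?_⟩
  · exact (one_lt_inv₀ (neg_pos.2 hj0)).2 (by linarith [hpos j])
  · rw [hrq]
    exact neg_nonpos.2 (Real.log_nonneg (by linarith))
  · rw [hrq]
    exact neg_nonneg.2 (Real.log_nonpos (hpos j).le (by linarith))
  · rw [hrq, hrq]
    exact neg_le_neg (Real.log_le_log (hpos i) (by linarith [hk i]))
  · rw [hrq, hrq]
    exact neg_le_neg (Real.log_le_log (hpos j) (by linarith [hj i]))
  · have hn : ‖y - x‖ ≠ 0 := norm_ne_zero_iff.2 hw
    have e1 : ‖y - (x + -(q k)⁻¹ • (y - x))‖ = (1 + (q k)⁻¹) * ‖y - x‖ := by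
      rw [show y - (x + -(q k)⁻¹ • (y - x)) = (1 + (q k)⁻¹) • (y - x) by module, norm_smul,
        Real.norm_of_nonneg (by positivity)]
    have e2 : ‖x - (x + -(q k)⁻¹ • (y - x))‖ = (q k)⁻¹ * ‖y - x‖ := by
      rw [show x - (x + -(q k)⁻¹ • (y - x)) = (q k)⁻¹ • (y - x) by module, norm_smul,
        Real.norm_of_nonneg (by positivity)]
    have e3 : ‖x - (x + (-q j)⁻¹ • (y - x))‖ = (-q j)⁻¹ * ‖y - x‖ := by
      rw [show x - (x + (-q j)⁻¹ • (y - x)) = -((-q j)⁻¹ • (y - x)) by module, norm_neg, norm_smul,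
        Real.norm_of_nonneg (inv_nonneg.2 (by linarith))]
    have h1 : 1 < (-q j)⁻¹ := (one_lt_inv₀ (neg_pos.2 hj0)).2 (by linarith [hpos j])
    have e4 : ‖y - (x + (-q j)⁻¹ • (y - x))‖ = ((-q j)⁻¹ - 1) * ‖y - x‖ := by
      rw [show y - (x + (-q j)⁻¹ • (y - x)) = -(((-q j)⁻¹ - 1) • (y - x)) by module, norm_neg,
        norm_smul, Real.norm_of_nonneg (by linarith)]
    have hcr : ‖y - (x + -(q k)⁻¹ • (y - x))‖ / ‖x - (x + -(q k)⁻¹ • (y - x))‖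
        * (‖x - (x + (-q j)⁻¹ • (y - x))‖ / ‖y - (x + (-q j)⁻¹ • (y - x))‖)
        = (1 + q k) / (1 + q j) := by
      rw [e1, e2, e3, e4, mul_div_mul_right _ _ hn, mul_div_mul_right _ _ hn]
      have h2 := (hpos j).ne'
      have h3 := hj0.ne
      have h4 : (-q j)⁻¹ - 1 = (1 + q j) / (-q j) := by
        field_simp
        ring
      rw [h4]
      field_simp
      ring
    change Real.log (‖y - (x + -(q k)⁻¹ • (y - x))‖ / ‖x - (x + -(q k)⁻¹ • (y - x))‖
        * (‖x - (x + (-q j)⁻¹ • (y - x))‖ / ‖y - (x + (-q j)⁻¹ • (y - x))‖)) = _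
    rw [hcr, Real.log_div (hpos k).ne' (hpos j).ne', hrq, hrq]
    ring

/-- Gradient inequality for the convex function `t ↦ t log t - t`. -/
theorem entropy_add_mul_log_le {a c : ℝ} (ha : 0 ≤ a) (hc : 0 < c) :
    c * Real.log c - c + (a - c) * Real.log c ≤ a * Real.log a - a := by
  rcases ha.eq_or_lt with rfl | ha
  · simpa using hc.le
  · linarith [sub_le_mul_log_sub_log ha hc]

theorem sub_mul_log_segment_le {a c t : ℝ} (ha : 0 ≤ a) (hc : 0 < c) (ht0 : 0 < t) (ht1 : t ≤ 1) :
    (c - a) * Real.log (a + t * (c - a)) ≤ (c - a) * Real.log c := by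
  have hs : 0 < a + t * (c - a) := by nlinarith [mul_pos ht0 hc, mul_nonneg (sub_nonneg.2 ht1) ha]
  rcases le_total a c with h | h
  · exact mul_le_mul_of_nonneg_left (Real.log_le_log hs (by nlinarith)) (sub_nonneg.2 h)
  · exact mul_le_mul_of_nonpos_left (Real.log_le_log hc (by nlinarith)) (sub_nonpos.2 h)

/-- A point `x` of the polytope minimizing `∑ i, (f i log (f i) - f i) - ⟪v, ·⟫` is interior,
because the slope of `t log t - t` at `0` is `-∞`. -/
theorem pos_of_forall_entropy_le [Fintype ι] {g : ι → E} {b : ι → ℝ} {v x z : E}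
    (hx : x ∈ polyhedron g b) (hz : ∀ i, 0 < ⟪g i, z⟫ + b i)
    (hmin : ∀ y ∈ polyhedron g b,
      ∑ i, ((⟪g i, x⟫ + b i) * Real.log (⟪g i, x⟫ + b i) - (⟪g i, x⟫ + b i)) - ⟪v, x⟫
        ≤ ∑ i, ((⟪g i, y⟫ + b i) * Real.log (⟪g i, y⟫ + b i) - (⟪g i, y⟫ + b i)) - ⟪v, y⟫)
    (i : ι) : 0 < ⟪g i, x⟫ + b i := by
  classical
  by_contra hi
  have hi0 : ⟪g i, x⟫ + b i = 0 := le_antisymm (not_lt.1 hi) (hx i)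
  set a : ι → ℝ := fun i => ⟪g i, x⟫ + b i with ha
  set c : ι → ℝ := fun i => ⟪g i, z⟫ + b i with hc
  have key : ∀ t : ℝ, 0 < t → t ≤ 1 →
      ⟪v, z - x⟫ ≤ ∑ k, (c k - a k) * Real.log (c k) + c i * Real.log t := by
    intro t ht0 ht1
    have hval : ∀ k, ⟪g k, x + t • (z - x)⟫ + b k = a k + t * (c k - a k) := fun k => by
      simp only [ha, hc, inner_add_right, inner_smul_right, inner_sub_right]
      ring
    have hpos : ∀ k, 0 < a k + t * (c k - a k) := fun k => by
      nlinarith [mul_pos ht0 (hz k), mul_nonneg (sub_nonneg.2 ht1) (hx k)]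
    have h := hmin (x + t • (z - x)) fun k => by
      rw [hval]
      exact (hpos k).le
    simp only [hval] at h
    have hgrad := Finset.sum_le_sum fun k (_ : k ∈ Finset.univ) =>
      entropy_add_mul_log_le (hx k) (hpos k)
    rw [Finset.sum_add_distrib, inner_add_right, inner_smul_right] at *
    have hslope : t * ∑ k, (c k - a k) * Real.log (a k + t * (c k - a k))
        = -∑ k, (a k - (a k + t * (c k - a k))) * Real.log (a k + t * (c k - a k)) := by
      rw [Finset.mul_sum, ← Finset.sum_neg_distrib]
      exact Finset.sum_congr rfl fun k _ => by ring
    have h1 : t * ⟪v, z - x⟫ ≤ t * ∑ k, (c k - a k) * Real.log (a k + t * (c k - a k)) := by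
      rw [hslope]
      linarith
    refine (le_of_mul_le_mul_left h1 ht0).trans ?_
    rw [← Finset.add_sum_erase _ _ (Finset.mem_univ i),
      ← Finset.add_sum_erase (a := i) _ (fun k => (c k - a k) * Real.log (c k)) (Finset.mem_univ i)]
    have h2 : (c i - a i) * Real.log (a i + t * (c i - a i))
        = (c i - a i) * Real.log (c i) + c i * Real.log t := by
      rw [show a i = 0 from hi0, sub_zero, zero_add, Real.log_mul ht0.ne' (hz i).ne']
      ring
    have h3 := Finset.sum_le_sum fun k (_ : k ∈ Finset.univ.erase i) =>
      sub_mul_log_segment_le (hx k) (hz k) ht0 ht1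
    linarith
  set K := ∑ k, (c k - a k) * Real.log (c k)
  have hci : 0 < c i := hz i
  have h := key (Real.exp (-((|K - ⟪v, z - x⟫| + 1) / c i))) (Real.exp_pos _)
    (Real.exp_le_one_iff.2 (neg_nonpos.2 (by positivity)))
  rw [Real.log_exp, mul_neg, mul_div_cancel₀ _ hci.ne'] at h
  linarith [neg_abs_le (K - ⟪v, z - x⟫), le_abs_self (K - ⟪v, z - x⟫)]

theorem exists_sum_log_smul_eq [Fintype ι] {g : ι → E} {b : ι → ℝ}
    (hP : IsCompact (polyhedron g b)) {z : E} (hz : ∀ i, 0 < ⟪g i, z⟫ + b i) (v : E) :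
    ∃ x, (∀ i, 0 < ⟪g i, x⟫ + b i) ∧ ∑ i, Real.log (⟪g i, x⟫ + b i) • g i = v := by
  let h : E → ℝ := fun y =>
    ∑ i, ((⟪g i, y⟫ + b i) * Real.log (⟪g i, y⟫ + b i) - (⟪g i, y⟫ + b i)) - ⟪v, y⟫
  have hcont : Continuous h := by
    refine Continuous.sub (continuous_finsetSum _ fun i _ => ?_) (by fun_prop)
    have hf : Continuous fun y => ⟪g i, y⟫ + b i := by fun_prop
    exact (Real.continuous_mul_log.comp hf).sub hf
  obtain ⟨x, hx, hmin⟩ := hP.exists_isMinOn ⟨z, fun i => (hz i).le⟩ hcont.continuousOn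
  have hpos := pos_of_forall_entropy_le hx hz hmin
  refine ⟨x, hpos, ?_⟩
  have hnhds : polyhedron g b ∈ nhds x := by
    have : ∀ᶠ y in nhds x, ∀ i, 0 < ⟪g i, y⟫ + b i :=
      Filter.eventually_all.2 fun i =>
        (show Continuous fun y => ⟪g i, y⟫ + b i by fun_prop).continuousAt.eventually
          (lt_mem_nhds (hpos i))
    filter_upwards [this] with y hy i using (hy i).le
  have hderiv : HasFDerivAt h
      (∑ i, Real.log (⟪g i, x⟫ + b i) • innerSL ℝ (g i) - innerSL ℝ v) x := by
    refine HasFDerivAt.sub (HasFDerivAt.fun_sum fun i _ => ?_) (innerSL ℝ v).hasFDerivAt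
    have hf : HasFDerivAt (fun y => ⟪g i, y⟫ + b i) (innerSL ℝ (g i)) x :=
      (innerSL ℝ (g i)).hasFDerivAt.add_const (b i)
    have hφ : HasDerivAt (fun t : ℝ => t * Real.log t - t) (Real.log (⟪g i, x⟫ + b i))
        (⟪g i, x⟫ + b i) := by
      have := (Real.hasDerivAt_mul_log (hpos i).ne').fun_sub (hasDerivAt_id' _)
      rwa [add_sub_cancel_right] at this
    exact hφ.comp_hasFDerivAt x hf
  have hzero := (hmin.isLocalMin hnhds).hasFDerivAt_eq_zero hderiv
  refine ext_inner_right ℝ fun u => ?_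
  have := DFunLike.congr_fun hzero u
  simp only [sub_apply, sum_apply,
    smul_apply, innerSL_apply_apply, smul_eq_mul,
    zero_apply] at this
  simp only [sum_inner, inner_smul_left, conj_trivial]
  linarith

end Polytope

/-- For a simple compact convex polytope `P`, property (A) holds: `‖dΦₓ(w)‖ ≥ C‖w‖ₓ` for some
`C > 0`; consequently the Hilbert metric of `P` is bilipschitz to Euclidean `ℝⁿ` via `Φ`. -/
theorem simple_polytope_bilipschitz {n m : ℕ}
    (g : Fin m → EuclideanSpace ℝ (Fin n)) (b : Fin m → ℝ)
    (hg : ∀ i, g i ≠ 0)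
    (P : Set (EuclideanSpace ℝ (Fin n)))
    (hP : P = {x | ∀ i, 0 ≤ ⟪g i, x⟫ + b i})
    (hPcomp : IsCompact P) (hPint : (interior P).Nonempty)
    -- P is simple: every vertex lies on exactly n of the hyperplanes
    (hsimple : ∀ p ∈ Set.extremePoints ℝ P, {i : Fin m | ⟪g i, p⟫ + b i = 0}.ncard = n)
    -- the Hilbert Finsler norm
    (N : EuclideanSpace ℝ (Fin n) → EuclideanSpace ℝ (Fin n) → ℝ)
    (hN0 : ∀ x, N x 0 = 0)
    (hN : ∀ x ∈ interior P, ∀ w : EuclideanSpace ℝ (Fin n), w ≠ 0 →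
      ∀ t1 t2 : ℝ, 0 < t1 → 0 < t2 →
        x + t1 • w ∈ frontier P → x - t2 • w ∈ frontier P →
        N x w = (1/2) * (1/t1 + 1/t2))
    -- the Hilbert metric
    (d : EuclideanSpace ℝ (Fin n) → EuclideanSpace ℝ (Fin n) → ℝ)
    (hd0 : ∀ x, d x x = 0)
    (hd : ∀ x y, x ∈ interior P → y ∈ interior P → x ≠ y →
      ∀ a1 a2 : EuclideanSpace ℝ (Fin n), a1 ∈ frontier P → a2 ∈ frontier P →
      (∃ t1 t2 : ℝ, t1 < 0 ∧ 1 < t2 ∧ a1 = x + t1 • (y - x) ∧ a2 = x + t2 • (y - x)) →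
      d x y = (1/2) * Real.log ((‖y - a1‖ / ‖x - a1‖) * (‖x - a2‖ / ‖y - a2‖)))
    (Φ : EuclideanSpace ℝ (Fin n) → EuclideanSpace ℝ (Fin n))
    (hΦ : ∀ x, Φ x = ∑ i, Real.log (⟪g i, x⟫ + b i) • g i) :
    (∃ C > 0, ∀ x ∈ interior P, ∀ w : EuclideanSpace ℝ (Fin n),
        C * N x w ≤ ‖∑ i, ((⟪g i, w⟫ / (⟪g i, x⟫ + b i)) • g i)‖) ∧
      Φ '' interior P = Set.univ ∧
      ∃ C1 > 0, ∃ C2 > 0, ∀ x ∈ interior P, ∀ y ∈ interior P,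
        C1 * d x y ≤ ‖Φ x - Φ y‖ ∧ ‖Φ x - Φ y‖ ≤ C2 * d x y := by
  have hset : P = polyhedron g b := hP
  subst hset
  have hint := interior_polyhedron b hg
  have hbdd := hPcomp.isBounded
  have hsimple' : ∀ p ∈ Set.extremePoints ℝ (polyhedron g b),
      {i | ⟪g i, p⟫ + b i = 0}.ncard = Module.finrank ℝ (EuclideanSpace ℝ (Fin n)) := fun p hp => by
    rw [hsimple p hp, finrank_euclideanSpace_fin]
  rw [hint] at hN hd hPint ⊢
  obtain ⟨z, hz⟩ := hPint
  refine ⟨?_, ?_, ?_⟩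
  · obtain ⟨C, hC, h⟩ := exists_pos_mul_norm_logDeriv_le hPcomp hsimple'
    refine ⟨C, hC, fun x hx w => le_trans (mul_le_mul_of_nonneg_left ?_ hC.le) (h x hx w)⟩
    rcases eq_or_ne w 0 with rfl | hw
    · rw [hN0]
      exact norm_nonneg _
    set q : Fin m → ℝ := fun i => ⟪g i, w⟫ / (⟪g i, x⟫ + b i) with hq
    obtain ⟨j, hj0, -, hja⟩ := exists_exit_point hg hbdd hx hw
    obtain ⟨k, hk0, -, hka⟩ := exists_exit_point hg hbdd hx (neg_ne_zero.2 hw)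
    have hqneg : ⟪g k, -w⟫ / (⟪g k, x⟫ + b k) = -q k := by rw [inner_neg_right, neg_div]
    rw [hqneg] at hk0 hka
    rw [neg_neg, smul_neg, ← sub_eq_add_neg] at hka
    rw [hN x hx w hw _ _ (inv_pos.2 (neg_pos.2 hj0)) (inv_pos.2 (neg_lt_zero.1 hk0)) hja hka]
    have h1 : |q j| ≤ ‖q‖ := norm_le_pi_norm q j
    have h2 : |q k| ≤ ‖q‖ := norm_le_pi_norm q k
    have h3 := neg_le_abs (q j)
    have h4 := le_abs_self (q k)
    simp only [one_div, inv_inv]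
    change 2⁻¹ * (-q j + q k) ≤ ‖q‖
    linarith
  · refine Set.eq_univ_of_forall fun v => ?_
    obtain ⟨x, hx, hv⟩ := exists_sum_log_smul_eq hPcomp hz v
    exact ⟨x, hx, (hΦ x).trans hv⟩
  · obtain ⟨C, hC, h⟩ := exists_pos_mul_norm_log_sub_log_le hPcomp hsimple'
    refine ⟨C, hC, 2 * ∑ i, ‖g i‖ + 1, by positivity, fun x hx y hy => ?_⟩
    set r : Fin m → ℝ := fun i => Real.log (⟪g i, x⟫ + b i) - Real.log (⟪g i, y⟫ + b i) with hr
    have hΦr : Φ x - Φ y = ∑ i, r i • g i := by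
      simp only [hΦ, hr, sub_smul, Finset.sum_sub_distrib]
    obtain ⟨hd1, hd2⟩ : d x y ≤ ‖r‖ ∧ ‖r‖ ≤ 2 * d x y := by
      rcases eq_or_ne x y with rfl | hxy
      · have hr0 : r = 0 := by
          ext i
          simp [hr]
        simp [hd0, hr0]
      obtain ⟨a₁, ha₁, a₂, ha₂, ht, j, k, hk0, hj0, hjk, hlog⟩ :=
        exists_log_cross_ratio_eq hg hbdd hx hy hxy fun i => (rfl : r i = _)
      rw [hd x y hx hy hxy a₁ a₂ ha₁ ha₂ ht, hlog]
      have h1 : |r j| ≤ ‖r‖ := norm_le_pi_norm r j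
      have h2 : |r k| ≤ ‖r‖ := norm_le_pi_norm r k
      refine ⟨by linarith [le_abs_self (r j), neg_le_abs (r k)], ?_⟩
      refine (pi_norm_le_iff_of_nonneg (by linarith)).2 fun i => abs_le.2 ?_
      constructor <;> linarith [hjk i]
    rw [hΦr]
    refine ⟨(mul_le_mul_of_nonneg_left hd1 hC.le).trans (h x y hx hy), ?_⟩
    calc ‖∑ i, r i • g i‖ ≤ ∑ i, ‖r i • g i‖ := norm_sum_le _ _
      _ ≤ ∑ i, ‖r‖ * ‖g i‖ := Finset.sum_le_sum fun i _ => by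
          rw [norm_smul]
          exact mul_le_mul_of_nonneg_right (norm_le_pi_norm r i) (norm_nonneg _)
      _ = ‖r‖ * ∑ i, ‖g i‖ := (Finset.mul_sum ..).symm
      _ ≤ 2 * d x y * ∑ i, ‖g i‖ := by gcongr
      _ ≤ (2 * ∑ i, ‖g i‖ + 1) * d x y := by linarith [norm_nonneg r]
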